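/- Fix real λ and real η and set v₀ = −λ² − λ − η², ε̂₁ = v₀/2, ε̂₂ = η(3v₀−1)/4, ε̂₃ = (22η²v₀ − 19η² − 7v₀² + 6v₀)/24. For ρ₀ > 0 define ε = ε̂₁/ρ₀ + ε̂₂/ρ₀² + ε̂₃/ρ₀³, δ = ε − η·ln(1 + ε/ρ₀), and ρ = ρ₀ + ε. Then −sin(δ)·Σ_{k=0}^{3} r_k/(2ρ)^k + cos(δ)·Σ_{k=0}^{3} s_k/(2ρ)^k = O(ρ₀^{−4}) as ρ₀ → ∞. Here (p_k), (q_k) are defined by p₀ = 1, q₀ = 0, and for k ≥ 0, (k+1)·p_{k+1} = u_k·p_k + v_k·q_k and (k+1)·q_{k+1} = −v_k·p_k + u_k·q_k with u_k = η(2k+1), v_k = k + k² − λ² − λ − η²; and r₀ = 1, s₀ = 0, r_{k+1} = p_{k+1} − 2η·p_k − 2k·q_k, s_{k+1} = −q_{k+1} + 2η·q_k − 2k·p_k. -/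

import Mathlib

open Real Filter Asymptotics
open scoped Topology

/-- `HasCubicJet f a b c d` says that `f x = a + b x + c x² + d x³ + O(x⁴)` as `x → 0`. -/
def HasCubicJet (f : ℝ → ℝ) (a b c d : ℝ) : Prop :=
  (fun x => f x - (a + b * x + c * x ^ 2 + d * x ^ 3)) =O[𝓝 0] fun x : ℝ => x ^ 4

namespace HasCubicJet

variable {f g : ℝ → ℝ} {a b c d a' b' c' d' : ℝ}

lemma polynomial (a b c d : ℝ) :
    HasCubicJet (fun x => a + b * x + c * x ^ 2 + d * x ^ 3) a b c d := by
  simpa [HasCubicJet] using isBigO_zero (fun x : ℝ => x ^ 4) (𝓝 (0 : ℝ))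

lemma const (a : ℝ) : HasCubicJet (fun _ => a) a 0 0 0 := by
  simpa using polynomial a 0 0 0

lemma ident : HasCubicJet (fun x => x) 0 1 0 0 := by
  simpa using polynomial 0 1 0 0

lemma of_sub_isBigO (hf : HasCubicJet f a b c d)
    (h : (fun x => g x - f x) =O[𝓝 0] fun x : ℝ => x ^ 4) : HasCubicJet g a b c d :=
  (IsBigO.add h hf).congr_left fun x => by ring

lemma add (hf : HasCubicJet f a b c d) (hg : HasCubicJet g a' b' c' d') :
    HasCubicJet (fun x => f x + g x) (a + a') (b + b') (c + c') (d + d') :=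
  (IsBigO.add hf hg).congr_left fun x => by ring

lemma const_mul (k : ℝ) (hf : HasCubicJet f a b c d) :
    HasCubicJet (fun x => k * f x) (k * a) (k * b) (k * c) (k * d) :=
  (IsBigO.const_mul_left hf k).congr_left fun x => by ring

lemma isBigO_one_of_continuousAt {u : ℝ → ℝ} (hu : ContinuousAt u 0) :
    u =O[𝓝 0] fun _ => (1 : ℝ) :=
  hu.tendsto.isBigO_one ℝ

lemma isBigO_pow_four_mul {u : ℝ → ℝ} (hu : ContinuousAt u 0) :
    (fun x => x ^ 4 * u x) =O[𝓝 0] fun x : ℝ => x ^ 4 := by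
  simpa using (isBigO_refl (fun x : ℝ => x ^ 4) (𝓝 0)).mul (isBigO_one_of_continuousAt hu)

lemma mul (hf : HasCubicJet f a b c d) (hg : HasCubicJet g a' b' c' d') :
    HasCubicJet (fun x => f x * g x) (a * a') (a * b' + b * a') (a * c' + b * b' + c * a')
      (a * d' + b * c' + c * b' + d * a') := by
  have bounded (a b c d : ℝ) :
      (fun x : ℝ => a + b * x + c * x ^ 2 + d * x ^ 3) =O[𝓝 0] fun _ => (1 : ℝ) :=
    isBigO_one_of_continuousAt (by fun_prop)
  have hg_bounded : g =O[𝓝 0] fun _ => (1 : ℝ) := by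
    have hpow : (fun x : ℝ => x ^ 4) =O[𝓝 0] fun _ => (1 : ℝ) :=
      isBigO_one_of_continuousAt (by fun_prop)
    exact ((IsBigO.trans hg hpow).add (bounded a' b' c' d')).congr_left fun x => by ring
  have h₁ := IsBigO.mul hf hg_bounded
  have h₂ := (bounded a b c d).mul hg
  have h₃ : (fun x : ℝ => x ^ 4 * (b * d' + c * c' + d * b' + (c * d' + d * c') * x
      + d * d' * x ^ 2)) =O[𝓝 0] fun x : ℝ => x ^ 4 :=
    isBigO_pow_four_mul (by fun_prop)
  simp only [mul_one, one_mul] at h₁ h₂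
  exact ((h₁.add h₂).add h₃).congr_left fun x => by ring

lemma isBigO_pow_four (hf : HasCubicJet f a b c d) (ha : a = 0) (hb : b = 0) (hc : c = 0)
    (hd : d = 0) : f =O[𝓝 0] fun x : ℝ => x ^ 4 := by
  simpa [HasCubicJet, ha, hb, hc, hd] using hf

lemma isBigO_sq (hf : HasCubicJet f 0 0 c d) : f =O[𝓝 0] fun x : ℝ => x ^ 2 := by
  have hpow : (fun x : ℝ => x ^ 4) =O[𝓝 0] fun x : ℝ => x ^ 2 := by
    have h : (fun x : ℝ => x ^ 2) =O[𝓝 0] fun _ => (1 : ℝ) :=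
      isBigO_one_of_continuousAt (by fun_prop)
    exact ((isBigO_refl (fun x : ℝ => x ^ 2) (𝓝 0)).mul h).congr (fun x => by ring)
      (fun x => by ring)
  have hpoly : (fun x : ℝ => x ^ 2 * (c + d * x)) =O[𝓝 0] fun x : ℝ => x ^ 2 := by
    have h : (fun x : ℝ => c + d * x) =O[𝓝 0] fun _ => (1 : ℝ) :=
      isBigO_one_of_continuousAt (by fun_prop)
    simpa using (isBigO_refl (fun x : ℝ => x ^ 2) (𝓝 0)).mul h
  exact ((IsBigO.trans hf hpow).add hpoly).congr_left fun x => by ring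

lemma isBigO_ident (hf : HasCubicJet f 0 b c d) : f =O[𝓝 0] fun x : ℝ => x := by
  have hpow : (fun x : ℝ => x ^ 4) =O[𝓝 0] fun x : ℝ => x := by
    have h : (fun x : ℝ => x ^ 3) =O[𝓝 0] fun _ => (1 : ℝ) :=
      isBigO_one_of_continuousAt (by fun_prop)
    exact ((isBigO_refl (fun x : ℝ => x) (𝓝 0)).mul h).congr (fun x => by ring)
      (fun x => by ring)
  have hpoly : (fun x : ℝ => x * (b + c * x + d * x ^ 2)) =O[𝓝 0] fun x : ℝ => x := by
    have h : (fun x : ℝ => b + c * x + d * x ^ 2) =O[𝓝 0] fun _ => (1 : ℝ) :=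
      isBigO_one_of_continuousAt (by fun_prop)
    simpa using (isBigO_refl (fun x : ℝ => x) (𝓝 0)).mul h
  exact ((IsBigO.trans hf hpow).add hpoly).congr_left fun x => by ring

lemma tendsto_zero (hf : HasCubicJet f 0 b c d) : Tendsto f (𝓝 0) (𝓝 0) :=
  hf.isBigO_ident.trans_tendsto tendsto_id

lemma eventually_abs_le (hf : HasCubicJet f 0 b c d) {r : ℝ} (hr : 0 < r) :
    ∀ᶠ x in 𝓝 0, |f x| ≤ r := by
  filter_upwards [Metric.tendsto_nhds.mp hf.tendsto_zero r hr] with x hx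
  simpa [Real.dist_eq] using hx.le

lemma sin (hf : HasCubicJet f 0 b c d) :
    HasCubicJet (fun x => Real.sin (f x)) 0 b c (d - b ^ 3 / 6) := by
  have hjet := hf.add (((hf.mul hf).mul hf).const_mul (-1 / 6))
  have hbound : (fun x => Real.sin (f x) - (f x - f x ^ 3 / 6)) =O[𝓝 0] fun x : ℝ => x ^ 4 := by
    refine IsBigO.trans (IsBigO.of_bound 1 ?_) (hf.isBigO_ident.pow 4)
    filter_upwards [hf.eventually_abs_le one_pos] with x hx
    have hpow : |f x| ^ 5 ≤ |f x| ^ 4 := pow_le_pow_of_le_one (abs_nonneg _) hx (by norm_num)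
    have hsin := Real.sin_bound hx
    have hnonneg : 0 ≤ |f x| ^ 5 := by positivity
    rw [Real.norm_eq_abs, norm_pow, Real.norm_eq_abs]
    linarith
  convert hjet.of_sub_isBigO (hbound.congr_left fun x => by ring) using 1 <;> ring

lemma cos (hf : HasCubicJet f 0 b c d) :
    HasCubicJet (fun x => Real.cos (f x)) 1 0 (-b ^ 2 / 2) (-b * c) := by
  have hjet := (const 1).add ((hf.mul hf).const_mul (-1 / 2))
  have hbound : (fun x => Real.cos (f x) - (1 - f x ^ 2 / 2)) =O[𝓝 0] fun x : ℝ => x ^ 4 := by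
    refine IsBigO.trans (IsBigO.of_bound (5 / 96) ?_) (hf.isBigO_ident.pow 4)
    filter_upwards [hf.eventually_abs_le one_pos] with x hx
    simpa [mul_comm] using Real.cos_bound hx
  convert hjet.of_sub_isBigO (hbound.congr_left fun x => by ring) using 1 <;> ring

lemma log_one_add (hf : HasCubicJet f 0 0 c d) :
    HasCubicJet (fun x => Real.log (1 + f x)) 0 0 c d := by
  refine hf.of_sub_isBigO ?_
  refine IsBigO.trans (IsBigO.of_bound 2 ?_)
    ((hf.isBigO_sq.pow 2).congr_right fun x => (pow_mul x 2 2).symm)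
  filter_upwards [hf.eventually_abs_le one_half_pos] with x hx
  have hpos : 0 < 1 + f x := by linarith [(abs_le.mp hx).1]
  have hupper := Real.log_le_sub_one_of_pos hpos
  have hlower := Real.one_sub_inv_le_log_of_pos hpos
  have hinv : (1 + f x)⁻¹ ≤ 1 - f x + 2 * f x ^ 2 := by
    rw [inv_le_iff_one_le_mul₀ hpos]
    nlinarith [sq_nonneg (f x), mul_nonneg (sq_nonneg (f x))
      (show (0 : ℝ) ≤ 1 + 2 * f x by linarith [(abs_le.mp hx).1])]
  rw [Real.norm_eq_abs, Real.norm_eq_abs, abs_of_nonneg (sq_nonneg (f x)), abs_le]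
  constructor <;> nlinarith [sq_nonneg (f x)]

lemma inv_one_add (hf : HasCubicJet f 0 0 c d) :
    HasCubicJet (fun x => (1 + f x)⁻¹) 1 0 (-c) (-d) := by
  have hjet := (const 1).add (hf.const_mul (-1))
  have hbound : (fun x => (1 + f x)⁻¹ - (1 + -1 * f x)) =O[𝓝 0] fun x : ℝ => x ^ 4 := by
    refine IsBigO.trans (IsBigO.of_bound 2 ?_)
      ((hf.isBigO_sq.pow 2).congr_right fun x => (pow_mul x 2 2).symm)
    filter_upwards [hf.eventually_abs_le one_half_pos] with x hx
    have hhalf : 1 / 2 ≤ 1 + f x := by linarith [(abs_le.mp hx).1]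
    have hpos : 0 < 1 + f x := by linarith
    have heq : (1 + f x)⁻¹ - (1 + -1 * f x) = (1 + f x)⁻¹ * f x ^ 2 := by
      field_simp
      ring
    have hinv : (1 + f x)⁻¹ ≤ 2 := by
      rw [inv_le_iff_one_le_mul₀ hpos]
      linarith
    rw [heq, norm_mul, Real.norm_of_nonneg (inv_nonneg.mpr hpos.le)]
    gcongr
  convert hjet.of_sub_isBigO hbound using 1 <;> ring

end HasCubicJet

/-- derivative case. With ε̂₁ = v₀/2, ε̂₂ = η(3v₀−1)/4,
ε̂₃ = (22η²v₀−19η²−7v₀²+6v₀)/24, ε = ε̂₁/ρ₀ + ε̂₂/ρ₀² + ε̂₃/ρ₀³, δ = ε − η ln(1+ε/ρ₀),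
ρ = ρ₀+ε, the truncation at k = 3 of −sin(δ)·Σ r_k/(2ρ)^k + cos(δ)·Σ s_k/(2ρ)^k is
O(ρ₀⁻⁴). -/
theorem coulomb_mcmahon_derivative_third_order (lam η v0 εh₁ εh₂ εh₃ : ℝ)
    (hv0 : v0 = -lam ^ 2 - lam - η ^ 2)
    (hεh₁ : εh₁ = v0 / 2) (hεh₂ : εh₂ = η * (3 * v0 - 1) / 4)
    (hεh₃ : εh₃ = (22 * η ^ 2 * v0 - 19 * η ^ 2 - 7 * v0 ^ 2 + 6 * v0) / 24)
    (p q r s : ℕ → ℝ) (hp0 : p 0 = 1) (hq0 : q 0 = 0)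
    (hp : ∀ k : ℕ, ((k : ℝ) + 1) * p (k + 1) =
      η * (2 * (k : ℝ) + 1) * p k +
        ((k : ℝ) + (k : ℝ) ^ 2 - lam ^ 2 - lam - η ^ 2) * q k)
    (hq : ∀ k : ℕ, ((k : ℝ) + 1) * q (k + 1) =
      -((k : ℝ) + (k : ℝ) ^ 2 - lam ^ 2 - lam - η ^ 2) * p k +
        η * (2 * (k : ℝ) + 1) * q k)
    (hr0 : r 0 = 1) (hs0 : s 0 = 0)
    (hr : ∀ k : ℕ, r (k + 1) = p (k + 1) - 2 * η * p k - 2 * (k : ℝ) * q k)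
    (hs : ∀ k : ℕ, s (k + 1) = -q (k + 1) + 2 * η * q k - 2 * (k : ℝ) * p k) :
    (fun ρ₀ : ℝ =>
        let ε : ℝ := εh₁ / ρ₀ + εh₂ / ρ₀ ^ 2 + εh₃ / ρ₀ ^ 3
        let δ : ℝ := ε - η * Real.log (1 + ε / ρ₀)
        let ρ : ℝ := ρ₀ + ε
        (-Real.sin δ) * (∑ k ∈ Finset.range 4, r k / (2 * ρ) ^ k) +
          Real.cos δ * (∑ k ∈ Finset.range 4, s k / (2 * ρ) ^ k))
      =O[atTop] fun ρ₀ : ℝ => ρ₀ ^ (-4 : ℤ) := by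
  have hp1 : p 1 = η := by simpa [hp0, hq0] using hp 0
  have hq1 : q 1 = -v0 := by
    have h := hq 0
    norm_num [hp0, hq0] at h
    linarith
  have hp2 : p 2 = (3 * η * p 1 + (2 + v0) * q 1) / 2 := by
    have h := hp 1
    norm_num at h
    rw [hv0]
    linarith
  have hq2 : q 2 = (-(2 + v0) * p 1 + 3 * η * q 1) / 2 := by
    have h := hq 1
    norm_num at h
    rw [hv0]
    linarith
  have hq3 : q 3 = (-(6 + v0) * p 2 + 5 * η * q 2) / 3 := by
    have h := hq 2
    norm_num at h
    rw [hv0]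
    linarith
  have hr1 := hr 0
  have hr2 := hr 1
  have hs1 := hs 0
  have hs2 := hs 1
  have hs3 := hs 2
  norm_num [hp0, hq0] at hr1 hr2 hs1 hs2 hs3
  have hε : HasCubicJet (fun x => 0 + εh₁ * x + εh₂ * x ^ 2 + εh₃ * x ^ 3) 0 εh₁ εh₂ εh₃ :=
    .polynomial 0 εh₁ εh₂ εh₃
  have hratio : HasCubicJet
      (fun x => (0 + εh₁ * x + εh₂ * x ^ 2 + εh₃ * x ^ 3) * x) 0 0 εh₁ εh₂ := by
    convert hε.mul .ident using 1 <;> ring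
  have hδ := hε.add (hratio.log_one_add.const_mul (-η))
  simp only [mul_zero, add_zero] at hδ
  have hy : HasCubicJet
      (fun x => 1 / 2 * (x * (1 + (0 + εh₁ * x + εh₂ * x ^ 2 + εh₃ * x ^ 3) * x)⁻¹))
      0 (1 / 2) 0 (-εh₁ / 2) := by
    convert (HasCubicJet.ident.mul hratio.inv_one_add).const_mul (1 / 2) using 1 <;> ring
  have hsum (t : ℕ → ℝ) := (((HasCubicJet.const (t 0)).add (hy.const_mul (t 1))).add
    ((hy.mul hy).const_mul (t 2))).add (((hy.mul hy).mul hy).const_mul (t 3))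
  have hmain := ((hδ.sin.const_mul (-1)).mul (hsum r)).add (hδ.cos.mul (hsum s))
  have hzero := hmain.isBigO_pow_four (by simp [hs0]) (by rw [hr0, hs0, hs1, hq1, hεh₁]; ring)
    (by
      rw [hr0, hs0, hr1, hs1, hs2, hq2, hp1, hq1, hεh₁, hεh₂]
      ring)
    (by
      rw [hr0, hs0, hr1, hr2, hs1, hs2, hs3, hq3, hp2, hq2, hp1, hq1, hεh₁, hεh₂, hεh₃]
      ring)
  refine (hzero.comp_tendsto tendsto_inv_atTop_zero).congr' ?_ ?_
  · filter_upwards [eventually_gt_atTop 0] with ρ₀ hρ₀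
    have hε_eq : 0 + εh₁ * ρ₀⁻¹ + εh₂ * ρ₀⁻¹ ^ 2 + εh₃ * ρ₀⁻¹ ^ 3 =
        εh₁ / ρ₀ + εh₂ / ρ₀ ^ 2 + εh₃ / ρ₀ ^ 3 := by
      simp only [div_eq_mul_inv, inv_pow, zero_add]
    simp only [Function.comp_apply, Finset.sum_range_succ, Finset.sum_range_zero, hε_eq]
    generalize εh₁ / ρ₀ + εh₂ / ρ₀ ^ 2 + εh₃ / ρ₀ ^ 3 = ε
    have hρ_inv : 1 / 2 * (ρ₀⁻¹ * (1 + ε * ρ₀⁻¹)⁻¹) = (2 * (ρ₀ + ε))⁻¹ := by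
      rw [← mul_inv, show ρ₀ * (1 + ε * ρ₀⁻¹) = ρ₀ + ε by field_simp, mul_inv, one_div]
    rw [hρ_inv, ← div_eq_mul_inv ε ρ₀, neg_mul η, ← sub_eq_add_neg]
    generalize 2 * (ρ₀ + ε) = w
    ring
  · exact Eventually.of_forall fun ρ₀ => by simp [zpow_neg, zpow_ofNat]
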